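/- arXiv:2508.12248 — 2 statements merged into one kernel-verified Lean document; each statement's English description precedes it below -/
import Mathlib

section
/- Let n, m ∈ ℕ, let X, X₀ ∈ ℂ^{n×m} be complex matrices, and let Y, Y₀ ∈ ℂ^{n×n} be Hermitian positive definite. Set A₀ = I_m + X₀^H Y₀^{−1} X₀, F₃ = Y₀ + X₀ X₀^H, and G = F₃^{−1} X₀ A₀ X₀^H F₃^{−1}. Then log det(I_m + X^H Y^{−1} X) ≥ − Re tr(G·(Y + X X^H)) + 2·Re tr(A₀ X₀^H F₃^{−1} X) + log det(A₀) − Re tr(X₀^H Y₀^{−1} X₀), where log det denotes the real logarithm of the (positive real) determinant of the respective Hermitian positive definite matrix. -/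
open Matrix ComplexOrder

namespace Matrix

variable {n m : Type*} [Fintype n] [Fintype m]

lemma PosDef.add_mul_conjTranspose_self {Y : Matrix n n ℂ} (hY : Y.PosDef)
    (X : Matrix n m ℂ) : (Y + X * Xᴴ).PosDef :=
  hY.add_posSemidef (posSemidef_self_mul_conjTranspose X)

variable [DecidableEq n] [DecidableEq m]

/-- The Hermitian positive definite case of `log x ≤ x - 1`. -/
lemma PosDef.log_det_le_trace_sub_card {M : Matrix m m ℂ} (hM : M.PosDef) :
    Real.log M.det.re ≤ M.trace.re - Fintype.card m := by
  have hdet : M.det.re = ∏ i, hM.1.eigenvalues i := by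
    rw [hM.1.det_eq_prod_eigenvalues]
    simp [← Complex.ofReal_prod]
  have htr : M.trace.re = ∑ i, hM.1.eigenvalues i := by
    rw [hM.1.trace_eq_sum_eigenvalues]
    simp
  rw [hdet, htr, Real.log_prod fun i _ => (hM.eigenvalues_pos i).ne']
  calc ∑ i, Real.log (hM.1.eigenvalues i)
      ≤ ∑ i, (hM.1.eigenvalues i - 1) :=
        Finset.sum_le_sum fun i _ => Real.log_le_sub_one_of_pos (hM.eigenvalues_pos i)
    _ = _ := by simp

open scoped MatrixOrder in
lemma PosDef.exists_isUnit_conjTranspose_mul_self {P : Matrix m m ℂ} (hP : P.PosDef) :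
    ∃ B : Matrix m m ℂ, IsUnit B ∧ P = Bᴴ * B := by
  obtain ⟨B, hB⟩ := CStarAlgebra.nonneg_iff_eq_star_mul_self.mp hP.posSemidef.nonneg
  refine ⟨B, ?_, hB⟩
  have h := hP.isUnit
  rw [hB] at h
  exact isUnit_of_mul_isUnit_right h

/-- The tangent bound for the concave function `log det`, in terms of the inverse. -/
lemma PosDef.log_det_sub_trace_mul_inv_le {P Q : Matrix m m ℂ} (hP : P.PosDef) (hQ : Q.PosDef) :
    Real.log Q.det.re + Fintype.card m - (Q * P⁻¹).trace.re ≤ Real.log P.det.re := by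
  obtain ⟨B, hB, hPB⟩ := hP.inv.exists_isUnit_conjTranspose_mul_self
  have hM : (B * Q * Bᴴ).PosDef :=
    hQ.mul_mul_conjTranspose_same (vecMul_injective_of_isUnit hB)
  have htr : (B * Q * Bᴴ).trace = (Q * P⁻¹).trace := by
    rw [hPB, Matrix.mul_assoc, trace_mul_comm, Matrix.mul_assoc]
  have hdet : (B * Q * Bᴴ).det * P.det = Q.det := by
    have h : (Bᴴ * B).det * P.det = 1 := by
      rw [← hPB, ← det_mul, nonsing_inv_mul _ ((isUnit_iff_isUnit_det _).mp hP.isUnit), det_one]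
    rw [det_mul] at h
    rw [det_mul, det_mul]
    linear_combination Q.det * h
  have hp := Complex.pos_iff.mp hP.det_pos
  have hm := Complex.pos_iff.mp hM.det_pos
  have hre : (B * Q * Bᴴ).det.re * P.det.re = Q.det.re := by
    rw [← hdet, Complex.mul_re, ← hp.2]
    simp
  have hlog := hM.log_det_le_trace_sub_card
  rw [htr] at hlog
  rw [← hre, Real.log_mul hm.1.ne' hp.1.ne']
  linarith

lemma PosDef.trace_mul_nonneg {Q S : Matrix m m ℂ} (hQ : Q.PosDef) (hS : S.PosSemidef) :
    0 ≤ (Q * S).trace.re := by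
  obtain ⟨B, -, rfl⟩ := hQ.exists_isUnit_conjTranspose_mul_self
  rw [Matrix.mul_assoc, trace_mul_comm]
  exact (Complex.nonneg_iff.mp (hS.mul_mul_conjTranspose_same B).trace_nonneg).1

lemma PosDef.one_add_conjTranspose_mul_inv_mul {Y : Matrix n n ℂ} (hY : Y.PosDef)
    (X : Matrix n m ℂ) : (1 + Xᴴ * Y⁻¹ * X).PosDef :=
  PosDef.one.add_posSemidef (hY.inv.posSemidef.conjTranspose_mul_mul_same X)

lemma PosDef.inv_one_add_conjTranspose_mul_inv_mul {Y : Matrix n n ℂ} (hY : Y.PosDef)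
    (X : Matrix n m ℂ) :
    (1 + Xᴴ * Y⁻¹ * X)⁻¹ = 1 - Xᴴ * (Y + X * Xᴴ)⁻¹ * X := by
  apply inv_eq_right_inv
  have hF := (isUnit_iff_isUnit_det _).mp (hY.add_mul_conjTranspose_self X).isUnit
  have hYu := (isUnit_iff_isUnit_det _).mp hY.isUnit
  set F := Y + X * Xᴴ with hFdef
  have hX : Y⁻¹ * (X * Xᴴ) * F⁻¹ = Y⁻¹ - F⁻¹ := by
    rw [show X * Xᴴ = F - Y by rw [hFdef]; abel, Matrix.mul_sub, Matrix.sub_mul,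
      nonsing_inv_mul _ hYu, Matrix.one_mul, Matrix.mul_assoc, mul_nonsing_inv _ hF,
      Matrix.mul_one]
  calc (1 + Xᴴ * Y⁻¹ * X) * (1 - Xᴴ * F⁻¹ * X)
      = 1 + Xᴴ * Y⁻¹ * X - Xᴴ * F⁻¹ * X - Xᴴ * (Y⁻¹ * (X * Xᴴ) * F⁻¹) * X := by
        simp only [Matrix.add_mul, Matrix.mul_sub, Matrix.mul_one, Matrix.one_mul,
          Matrix.mul_assoc]
        abel
    _ = 1 := by
        rw [hX]
        simp only [Matrix.mul_sub, Matrix.sub_mul]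
        abel

/-- Completing the square: any linear receiver `U` has error matrix at least the optimal one. -/
lemma PosDef.error_sub_inv_posSemidef {Y : Matrix n n ℂ} (hY : Y.PosDef) (X U : Matrix n m ℂ) :
    (1 - Uᴴ * X - Xᴴ * U + Uᴴ * (Y + X * Xᴴ) * U - (1 + Xᴴ * Y⁻¹ * X)⁻¹).PosSemidef := by
  have hFp := hY.add_mul_conjTranspose_self X
  rw [hY.inv_one_add_conjTranspose_mul_inv_mul X]
  set F := Y + X * Xᴴ
  have hF := (isUnit_iff_isUnit_det _).mp hFp.isUnit
  convert hFp.posSemidef.conjTranspose_mul_mul_same (U - F⁻¹ * X) using 1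
  rw [conjTranspose_sub, conjTranspose_mul, hFp.inv.isHermitian.eq]
  simp only [Matrix.sub_mul, Matrix.mul_sub, Matrix.mul_assoc, mul_nonsing_inv_cancel_left _ _ hF,
    nonsing_inv_mul_cancel_left _ _ hF]
  abel

end Matrix

theorem stmt_4 {n m : ℕ} (X X₀ : Matrix (Fin n) (Fin m) ℂ)
    (Y Y₀ : Matrix (Fin n) (Fin n) ℂ) (hY : Y.PosDef) (hY₀ : Y₀.PosDef) :
    let A₀ : Matrix (Fin m) (Fin m) ℂ := 1 + X₀ᴴ * Y₀⁻¹ * X₀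
    let F₃ : Matrix (Fin n) (Fin n) ℂ := Y₀ + X₀ * X₀ᴴ
    let G : Matrix (Fin n) (Fin n) ℂ := F₃⁻¹ * X₀ * A₀ * X₀ᴴ * F₃⁻¹
    Real.log ((1 + Xᴴ * Y⁻¹ * X).det.re) ≥
      -(Matrix.trace (G * (Y + X * Xᴴ))).re
      + 2 * (Matrix.trace (A₀ * X₀ᴴ * F₃⁻¹ * X)).re
      + Real.log (A₀.det.re)
      - (Matrix.trace (X₀ᴴ * Y₀⁻¹ * X₀)).re := by
  intro A₀ F₃ G
  have hA₀ : A₀.PosDef := hY₀.one_add_conjTranspose_mul_inv_mul X₀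
  have hF₃ : F₃.PosDef := hY₀.add_mul_conjTranspose_self X₀
  have htan := (hY.one_add_conjTranspose_mul_inv_mul X).log_det_sub_trace_mul_inv_le hA₀
  have herr := hA₀.trace_mul_nonneg (hY.error_sub_inv_posSemidef X (F₃⁻¹ * X₀))
  have hU : (F₃⁻¹ * X₀)ᴴ = X₀ᴴ * F₃⁻¹ := by
    rw [conjTranspose_mul, hF₃.inv.isHermitian.eq]
  have htrA : A₀.trace.re = m + (X₀ᴴ * Y₀⁻¹ * X₀).trace.re := by
    simp [A₀, trace_add]
  have hG : (A₀ * (X₀ᴴ * F₃⁻¹ * (Y + X * Xᴴ) * (F₃⁻¹ * X₀))).trace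
      = (G * (Y + X * Xᴴ)).trace := by
    have h : A₀ * (X₀ᴴ * F₃⁻¹ * (Y + X * Xᴴ) * (F₃⁻¹ * X₀))
        = A₀ * X₀ᴴ * F₃⁻¹ * (Y + X * Xᴴ) * (F₃⁻¹ * X₀) := by
      simp only [Matrix.mul_assoc]
    rw [h, trace_mul_comm]
    simp only [G, Matrix.mul_assoc]
  have hcross : (A₀ * (Xᴴ * (F₃⁻¹ * X₀))).trace.re = (A₀ * X₀ᴴ * F₃⁻¹ * X).trace.re := by
    have h : (A₀ * X₀ᴴ * F₃⁻¹ * X)ᴴ = Xᴴ * (F₃⁻¹ * X₀) * A₀ := by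
      simp only [conjTranspose_mul, hA₀.isHermitian.eq, hF₃.inv.isHermitian.eq,
        conjTranspose_conjTranspose, Matrix.mul_assoc]
    rw [trace_mul_comm, ← h, trace_conjTranspose]
    simp
  have hcross' : A₀ * (X₀ᴴ * F₃⁻¹ * X) = A₀ * X₀ᴴ * F₃⁻¹ * X := by
    simp only [Matrix.mul_assoc]
  rw [hU, Matrix.mul_sub, Matrix.mul_add, Matrix.mul_sub, Matrix.mul_sub, Matrix.mul_one,
    trace_sub, trace_add, trace_sub, trace_sub, hG, hcross'] at herr
  simp only [Complex.sub_re, Complex.add_re, hcross, htrA] at herr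
  rw [Fintype.card_fin] at htan
  linarith
end

section
/- Let n, m ∈ ℕ, let X₀ ∈ ℂ^{n×m}, and let Y₀ ∈ ℂ^{n×n} be Hermitian positive definite. Set A₀ = I_m + X₀^H Y₀^{−1} X₀, F₃ = Y₀ + X₀ X₀^H, and G = F₃^{−1} X₀ A₀ X₀^H F₃^{−1}. Then − Re tr(G·(Y₀ + X₀ X₀^H)) + 2·Re tr(A₀ X₀^H F₃^{−1} X₀) + log det(A₀) − Re tr(X₀^H Y₀^{−1} X₀) = log det(A₀); that is, the lower bound of the log-det minorant is attained with equality at X = X₀, Y = Y₀. -/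
open Matrix ComplexOrder

/-- Push-through identity: `(Y + X * Z)⁻¹ * X * (1 + Z * Y⁻¹ * X) = Y⁻¹ * X`. -/
theorem Matrix.inv_add_mul_mul_one_add_mul_inv_mul {m n R : Type*} [Fintype m] [DecidableEq m]
    [Fintype n] [DecidableEq n] [CommRing R] {X : Matrix n m R} {Z : Matrix m n R}
    {Y : Matrix n n R} (hY : IsUnit Y.det) (hF : IsUnit (Y + X * Z).det) :
    (Y + X * Z)⁻¹ * X * (1 + Z * Y⁻¹ * X) = Y⁻¹ * X := by
  have h : X * (1 + Z * Y⁻¹ * X) = (Y + X * Z) * (Y⁻¹ * X) := by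
    rw [Matrix.add_mul, Matrix.mul_nonsing_inv_cancel_left _ _ hY]
    simp only [Matrix.mul_add, Matrix.mul_one, Matrix.mul_assoc]
  rw [Matrix.mul_assoc, h, Matrix.nonsing_inv_mul_cancel_left _ _ hF]

theorem stmt_5 {n m : ℕ} (X₀ : Matrix (Fin n) (Fin m) ℂ)
    (Y₀ : Matrix (Fin n) (Fin n) ℂ) (hY₀ : Y₀.PosDef) :
    let A₀ : Matrix (Fin m) (Fin m) ℂ := 1 + X₀ᴴ * Y₀⁻¹ * X₀
    let F₃ : Matrix (Fin n) (Fin n) ℂ := Y₀ + X₀ * X₀ᴴ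
    let G : Matrix (Fin n) (Fin n) ℂ := F₃⁻¹ * X₀ * A₀ * X₀ᴴ * F₃⁻¹
    (-(Matrix.trace (G * (Y₀ + X₀ * X₀ᴴ))).re
        + 2 * (Matrix.trace (A₀ * X₀ᴴ * F₃⁻¹ * X₀)).re
        + Real.log (A₀.det.re)
        - (Matrix.trace (X₀ᴴ * Y₀⁻¹ * X₀)).re)
      = Real.log (A₀.det.re) := by
  intro A₀ F₃ G
  have hY : IsUnit Y₀.det := (Matrix.isUnit_iff_isUnit_det _).mp hY₀.isUnit
  have hF : IsUnit F₃.det := (Matrix.isUnit_iff_isUnit_det _).mp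
    (hY₀.add_posSemidef (posSemidef_self_mul_conjTranspose X₀)).isUnit
  have key : F₃⁻¹ * X₀ * A₀ = Y₀⁻¹ * X₀ := inv_add_mul_mul_one_add_mul_inv_mul hY hF
  have hG : (G * (Y₀ + X₀ * X₀ᴴ)).trace = (X₀ᴴ * Y₀⁻¹ * X₀).trace := by
    change (F₃⁻¹ * X₀ * A₀ * X₀ᴴ * F₃⁻¹ * F₃).trace = _
    rw [Matrix.nonsing_inv_mul_cancel_right _ _ hF, key, Matrix.trace_mul_comm, Matrix.mul_assoc]
  have hA : (A₀ * X₀ᴴ * F₃⁻¹ * X₀).trace = (X₀ᴴ * Y₀⁻¹ * X₀).trace := by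
    rw [Matrix.mul_assoc, Matrix.mul_assoc, Matrix.trace_mul_comm, Matrix.mul_assoc, key,
      Matrix.mul_assoc]
  rw [hG, hA]
  ring
end
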